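/- arXiv:2304.03814 — 3 statements merged into one kernel-verified Lean document; each statement's English description precedes it below -/
import Mathlib

section
/- Let F and G be noetherian forms over the same category, both having exact join decompositions. Then there are isomorphisms of forms F_c ≅ G_c and F_n ≅ G_n if and only if there is an isomorphism of forms F ≅ G. -/
open CategoryTheory

universe w v u

/-- A form over a category `C`, presented as a cluster system:
clusters per object and relations `B ≥_f A` (written `Rel f A B`),
satisfying (F1)-(F3). -/
structure Form (C : Type u) [Category.{v} C] where
  Cl : C → Type w
  Rel : ∀ {X Y : C}, (X ⟶ Y) → Cl X → Cl Y → Prop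
  rel_id : ∀ {X : C} (A : Cl X), Rel (𝟙 X) A A
  rel_comp : ∀ {X Y Z : C} {f : X ⟶ Y} {g : Y ⟶ Z} {A : Cl X} {B : Cl Y} {D : Cl Z},
      Rel f A B → Rel g B D → Rel (f ≫ g) A D
  rel_antisymm : ∀ {X : C} {A B : Cl X}, Rel (𝟙 X) A B → Rel (𝟙 X) B A → A = B

namespace Form

variable {C : Type u} [Category.{v} C]

/-- The fibre order on clusters. -/
def le (F : Form C) {X : C} (A B : F.Cl X) : Prop := F.Rel (𝟙 X) A B

/-- `S` is the image of `f`, i.e. the direct image of the top cluster of the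
domain of `f` along `f`. -/
def IsImageOf (F : Form C) {W X : C} (S : F.Cl X) (f : W ⟶ X) : Prop :=
  ∃ t : F.Cl W, (∀ A : F.Cl W, F.le A t) ∧ F.Rel f t S ∧ ∀ T : F.Cl X, F.Rel f t T → F.le S T

/-- `S` is the kernel of `g`, i.e. the inverse image of the bottom cluster of the
codomain of `g` along `g`. -/
def IsKernelOf (F : Form C) {X Y : C} (S : F.Cl X) (g : X ⟶ Y) : Prop :=
  ∃ b : F.Cl Y, (∀ A : F.Cl Y, F.le b A) ∧ F.Rel g S b ∧ ∀ T : F.Cl X, F.Rel g T b → F.le T S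

/-- A cluster is conormal when it is an image of some morphism. -/
def ConormalCl (F : Form C) {X : C} (S : F.Cl X) : Prop :=
  ∃ (W : C) (f : W ⟶ X), F.IsImageOf S f

/-- A cluster is normal when it is a kernel of some morphism. -/
def NormalCl (F : Form C) {X : C} (S : F.Cl X) : Prop :=
  ∃ (Y : C) (g : X ⟶ Y), F.IsKernelOf S g

/-- A form is conormal when every cluster is conormal. -/
def IsConormal (F : Form C) : Prop := ∀ (X : C) (S : F.Cl X), F.ConormalCl S

/-- A form is normal when every cluster is normal. -/
def IsNormal (F : Form C) : Prop := ∀ (X : C) (S : F.Cl X), F.NormalCl S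

def IsJoinOf (F : Form C) {X : C} (A B J : F.Cl X) : Prop :=
  F.le A J ∧ F.le B J ∧ ∀ D : F.Cl X, F.le A D → F.le B D → F.le J D

def IsMeetOf (F : Form C) {X : C} (A B M : F.Cl X) : Prop :=
  F.le M A ∧ F.le M B ∧ ∀ D : F.Cl X, F.le D A → F.le D B → F.le D M

/-- `T` is the direct image of `S` along `f`. -/
def IsDimgOf (F : Form C) {X Y : C} (f : X ⟶ Y) (S : F.Cl X) (T : F.Cl Y) : Prop :=
  F.Rel f S T ∧ ∀ T' : F.Cl Y, F.Rel f S T' → F.le T T'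

/-- `S` is the inverse image of `T` along `f`. -/
def IsIimgOf (F : Form C) {X Y : C} (f : X ⟶ Y) (T : F.Cl Y) (S : F.Cl X) : Prop :=
  F.Rel f S T ∧ ∀ S' : F.Cl X, F.Rel f S' T → F.le S' S

/-- Orean form: (O1) fibres are bounded lattices, (O3) direct and inverse images exist,
(O2) relations along composites decompose. -/
def IsOrean (F : Form C) : Prop :=
  (∀ X : C, ∃ b : F.Cl X, ∀ A, F.le b A) ∧
  (∀ X : C, ∃ t : F.Cl X, ∀ A, F.le A t) ∧
  (∀ (X : C) (A B : F.Cl X), ∃ J, F.IsJoinOf A B J) ∧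
  (∀ (X : C) (A B : F.Cl X), ∃ M, F.IsMeetOf A B M) ∧
  (∀ {X Y : C} (f : X ⟶ Y) (S : F.Cl X), ∃ T, F.IsDimgOf f S T) ∧
  (∀ {X Y : C} (f : X ⟶ Y) (T : F.Cl Y), ∃ S, F.IsIimgOf f T S) ∧
  (∀ {X Y Z : C} (f : X ⟶ Y) (g : Y ⟶ Z) (A : F.Cl X) (D : F.Cl Z),
      F.Rel (f ≫ g) A D → ∃ B : F.Cl Y, F.Rel f A B ∧ F.Rel g B D)

/-- `m` is an embedding of the (conormal) cluster `S`. -/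
def IsEmbeddingOf (F : Form C) {W X : C} (m : W ⟶ X) (S : F.Cl X) : Prop :=
  F.IsImageOf S m ∧ ∀ {W' : C} (f' : W' ⟶ X) (S' : F.Cl X),
    F.IsImageOf S' f' → F.le S' S → ∃! g : W' ⟶ W, g ≫ m = f'

/-- `e` is a quotient of the (normal) cluster `K`. -/
def IsQuotientOf (F : Form C) {X Y : C} (e : X ⟶ Y) (K : F.Cl X) : Prop :=
  F.IsKernelOf K e ∧ ∀ {Y' : C} (g' : X ⟶ Y') (K' : F.Cl X),
    F.IsKernelOf K' g' → F.le K K' → ∃! h : Y ⟶ Y', e ≫ h = g'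

/-- The axiom (N1) for a general form, stated via characterizing predicates. -/
def N1 (F : Form C) : Prop :=
  (∀ {X Y : C} (f : X ⟶ Y) (S V : F.Cl X) (T : F.Cl Y) (K J : F.Cl X),
      F.IsDimgOf f S T → F.IsIimgOf f T V → F.IsKernelOf K f → F.IsJoinOf S K J → V = J) ∧
  (∀ {X Y : C} (f : X ⟶ Y) (T : F.Cl Y) (S : F.Cl X) (U I M : F.Cl Y),
      F.IsIimgOf f T S → F.IsDimgOf f S U → F.IsImageOf I f → F.IsMeetOf T I M → U = M)

/-- The axiom (N2) for a general form. -/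
def N2 (F : Form C) : Prop :=
  ∀ {X Y : C} (f : X ⟶ Y), ∃ (I : C) (e : X ⟶ I) (m : I ⟶ Y) (K : F.Cl X) (S : F.Cl Y),
    F.IsKernelOf K f ∧ F.IsQuotientOf e K ∧ F.IsImageOf S f ∧ F.IsEmbeddingOf m S ∧ e ≫ m = f

/-- The axiom (N3) for a general form. -/
def N3 (F : Form C) : Prop :=
  (∀ {X : C} (S T J : F.Cl X), F.NormalCl S → F.NormalCl T → F.IsJoinOf S T J → F.NormalCl J) ∧
  (∀ {X : C} (S T M : F.Cl X), F.ConormalCl S → F.ConormalCl T → F.IsMeetOf S T M → F.ConormalCl M)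

/-- The subform of `F` given by a selection of clusters. -/
def Subform (F : Form C) (P : ∀ X : C, F.Cl X → Prop) : Form C where
  Cl X := {A : F.Cl X // P X A}
  Rel f A B := F.Rel f A.1 B.1
  rel_id A := F.rel_id A.1
  rel_comp h h' := F.rel_comp h h'
  rel_antisymm h h' := Subtype.ext (F.rel_antisymm h h')

/-- The product of two forms over the same category. -/
def prod (F G : Form C) : Form C where
  Cl X := F.Cl X × G.Cl X
  Rel f A B := F.Rel f A.1 B.1 ∧ G.Rel f A.2 B.2
  rel_id A := ⟨F.rel_id A.1, G.rel_id A.2⟩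
  rel_comp h h' := ⟨F.rel_comp h.1 h'.1, G.rel_comp h.2 h'.2⟩
  rel_antisymm h h' := Prod.ext (F.rel_antisymm h.1 h'.1) (G.rel_antisymm h.2 h'.2)

/-- Isomorphism of forms over the same category. -/
def IsIsomorphic (F G : Form C) : Prop :=
  ∃ e : ∀ X : C, F.Cl X ≃ G.Cl X,
    ∀ {X Y : C} (f : X ⟶ Y) (A : F.Cl X) (B : F.Cl Y),
      F.Rel f A B ↔ G.Rel f (e X A) (e Y B)

/-- An orean factorization (stated for general forms): a conormal orean form together
with a normal orean form such that every morphism factors as a quotient of its kernel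
followed by an embedding of its image. -/
def IsOreanFactorization (Fs Fe : Form C) : Prop :=
  Fs.IsOrean ∧ Fs.IsConormal ∧ Fe.IsOrean ∧ Fe.IsNormal ∧
  ∀ {X Y : C} (f : X ⟶ Y), ∃ (I : C) (e : X ⟶ I) (m : I ⟶ Y) (K : Fe.Cl X) (S : Fs.Cl Y),
    Fe.IsKernelOf K f ∧ Fe.IsQuotientOf e K ∧ Fs.IsImageOf S f ∧ Fs.IsEmbeddingOf m S ∧
    e ≫ m = f

end Form

/-- An operator between two forms over the same category. -/
structure Operator {C : Type u} [Category.{v} C] (F G : Form C) where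
  app : ∀ {X : C}, F.Cl X → G.Cl X
  mono : ∀ {X Y : C} {f : X ⟶ Y} {A : F.Cl X} {B : F.Cl Y},
      F.Rel f A B → G.Rel f (app A) (app B)

namespace Operator

variable {C : Type u} [Category.{v} C] {F G : Form C}

/-- A full operator. -/
def Full (τ : Operator F G) : Prop :=
  ∀ {X Y : C} {f : X ⟶ Y} {A : F.Cl X} {B : F.Cl Y},
    G.Rel f (τ.app A) (τ.app B) → F.Rel f A B

/-- A conormal operator: it maps images of morphisms to images. -/
def Conormal (τ : Operator F G) : Prop :=
  ∀ {W X : C} (f : W ⟶ X) (S : F.Cl X), F.IsImageOf S f → G.IsImageOf (τ.app S) f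

/-- A normal operator: it maps kernels of morphisms to kernels. -/
def Normal (τ : Operator F G) : Prop :=
  ∀ {X Y : C} (g : X ⟶ Y) (S : F.Cl X), F.IsKernelOf S g → G.IsKernelOf (τ.app S) g

end Operator

/-- The identity operator. -/
def Form.idOp {C : Type u} [Category.{v} C] (F : Form C) : Operator F F :=
  ⟨fun A => A, fun h => h⟩

/-- The inclusion of a subform. -/
def Form.subformIncl {C : Type u} [Category.{v} C] (F : Form C) (P : ∀ X : C, F.Cl X → Prop) :
    Operator (F.Subform P) F where
  app A := A.1
  mono h := h

/-- The subform of clusters fixed by an operator `κ : F → F`. -/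
def Form.fixedSubform {C : Type u} [Category.{v} C] (F : Form C) (κ : Operator F F) : Form C :=
  F.Subform (fun _ A => κ.app A = A)

/-- A semiexact pair of forms. -/
def IsSemiexactPair {C : Type u} [Category.{v} C] (Fs Fe : Form C) : Prop :=
  Fs.IsOrean ∧ Fs.IsConormal ∧ Fe.IsOrean ∧ Fe.IsNormal ∧
  (∃ α : Operator Fs Fe, α.Conormal) ∧ (∃ β : Operator Fe Fs, β.Normal)

/-- A left exact pair of forms: a semiexact pair where the conormal operator is a
left inverse of the normal operator. -/
def IsLeftExactPair {C : Type u} [Category.{v} C] (Fs Fe : Form C) : Prop :=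
  Fs.IsOrean ∧ Fs.IsConormal ∧ Fe.IsOrean ∧ Fe.IsNormal ∧
  ∃ (α : Operator Fs Fe) (β : Operator Fe Fs), α.Conormal ∧ β.Normal ∧
    ∀ {X : C} (R : Fe.Cl X), α.app (β.app R) = R

/-- An orean form, with the (uniquely determined) bounded-lattice and
direct/inverse image structure bundled. -/
structure OreanForm (C : Type u) [Category.{v} C] extends Form C where
  bot : ∀ X : C, Cl X
  top : ∀ X : C, Cl X
  join : ∀ {X : C}, Cl X → Cl X → Cl X
  meet : ∀ {X : C}, Cl X → Cl X → Cl X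
  dimg : ∀ {X Y : C}, (X ⟶ Y) → Cl X → Cl Y
  iimg : ∀ {X Y : C}, (X ⟶ Y) → Cl Y → Cl X
  bot_le : ∀ {X : C} (A : Cl X), Rel (𝟙 X) (bot X) A
  le_top : ∀ {X : C} (A : Cl X), Rel (𝟙 X) A (top X)
  le_join_left : ∀ {X : C} (A B : Cl X), Rel (𝟙 X) A (join A B)
  le_join_right : ∀ {X : C} (A B : Cl X), Rel (𝟙 X) B (join A B)
  join_le : ∀ {X : C} {A B D : Cl X}, Rel (𝟙 X) A D → Rel (𝟙 X) B D → Rel (𝟙 X) (join A B) D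
  meet_le_left : ∀ {X : C} (A B : Cl X), Rel (𝟙 X) (meet A B) A
  meet_le_right : ∀ {X : C} (A B : Cl X), Rel (𝟙 X) (meet A B) B
  le_meet : ∀ {X : C} {A B D : Cl X}, Rel (𝟙 X) D A → Rel (𝟙 X) D B → Rel (𝟙 X) D (meet A B)
  rel_dimg : ∀ {X Y : C} (f : X ⟶ Y) (S : Cl X), Rel f S (dimg f S)
  dimg_le : ∀ {X Y : C} {f : X ⟶ Y} {S : Cl X} {T : Cl Y}, Rel f S T → Rel (𝟙 Y) (dimg f S) T
  iimg_rel : ∀ {X Y : C} (f : X ⟶ Y) (T : Cl Y), Rel f (iimg f T) T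
  le_iimg : ∀ {X Y : C} {f : X ⟶ Y} {S : Cl X} {T : Cl Y}, Rel f S T → Rel (𝟙 X) S (iimg f T)
  rel_decomp : ∀ {X Y Z : C} {f : X ⟶ Y} {g : Y ⟶ Z} {A : Cl X} {D : Cl Z},
      Rel (f ≫ g) A D → ∃ B : Cl Y, Rel f A B ∧ Rel g B D

namespace OreanForm

variable {C : Type u} [Category.{v} C]

def le (F : OreanForm C) {X : C} (A B : F.Cl X) : Prop := F.Rel (𝟙 X) A B

/-- The image of a morphism: direct image of the top cluster. -/
def Im (F : OreanForm C) {W X : C} (f : W ⟶ X) : F.Cl X := F.dimg f (F.top W)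

/-- The kernel of a morphism: inverse image of the bottom cluster. -/
def Ker (F : OreanForm C) {X Y : C} (g : X ⟶ Y) : F.Cl X := F.iimg g (F.bot Y)

def Conormal (F : OreanForm C) {X : C} (S : F.Cl X) : Prop :=
  ∃ (W : C) (f : W ⟶ X), F.Im f = S

def Normal (F : OreanForm C) {X : C} (S : F.Cl X) : Prop :=
  ∃ (Y : C) (g : X ⟶ Y), F.Ker g = S

def IsConormalForm (F : OreanForm C) : Prop := ∀ {X : C} (S : F.Cl X), F.Conormal S

def IsNormalForm (F : OreanForm C) : Prop := ∀ {X : C} (S : F.Cl X), F.Normal S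

def IsBinormalForm (F : OreanForm C) : Prop := F.IsConormalForm ∧ F.IsNormalForm

/-- `m` is an embedding of the cluster `S`. -/
def IsEmbedding (F : OreanForm C) {W X : C} (m : W ⟶ X) (S : F.Cl X) : Prop :=
  F.Im m = S ∧ ∀ {W' : C} (f' : W' ⟶ X), F.le (F.Im f') S → ∃! g : W' ⟶ W, g ≫ m = f'

/-- `e` is a quotient of the cluster `K`. -/
def IsQuotient (F : OreanForm C) {X Y : C} (e : X ⟶ Y) (K : F.Cl X) : Prop :=
  F.Ker e = K ∧ ∀ {Y' : C} (g' : X ⟶ Y'), F.le K (F.Ker g') → ∃! h : Y ⟶ Y', e ≫ h = g'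

/-- The axiom (N1) at a given morphism. -/
def N1At (F : OreanForm C) {X Y : C} (f : X ⟶ Y) : Prop :=
  (∀ S : F.Cl X, F.iimg f (F.dimg f S) = F.join S (F.Ker f)) ∧
  (∀ T : F.Cl Y, F.dimg f (F.iimg f T) = F.meet T (F.Im f))

def N1 (F : OreanForm C) : Prop := ∀ {X Y : C} (f : X ⟶ Y), F.N1At f

def N2 (F : OreanForm C) : Prop :=
  ∀ {X Y : C} (f : X ⟶ Y), ∃ (I : C) (e : X ⟶ I) (m : I ⟶ Y),
    F.IsQuotient e (F.Ker f) ∧ F.IsEmbedding m (F.Im f) ∧ e ≫ m = f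

def N3 (F : OreanForm C) : Prop :=
  (∀ {X : C} (S T : F.Cl X), F.Normal S → F.Normal T → F.Normal (F.join S T)) ∧
  (∀ {X : C} (S T : F.Cl X), F.Conormal S → F.Conormal T → F.Conormal (F.meet S T))

def IsNoetherian (F : OreanForm C) : Prop := F.N1 ∧ F.N2 ∧ F.N3

/-- The conormal hull: the subform of conormal clusters. -/
def conormalHull (F : OreanForm C) : Form C := F.toForm.Subform (fun _ S => F.Conormal S)

/-- The normal hull: the subform of normal clusters. -/
def normalHull (F : OreanForm C) : Form C := F.toForm.Subform (fun _ S => F.Normal S)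

def conormalIncl (F : OreanForm C) : Operator F.conormalHull F.toForm :=
  F.toForm.subformIncl _

def normalIncl (F : OreanForm C) : Operator F.normalHull F.toForm :=
  F.toForm.subformIncl _

/-- A strongly orean form: the conormal and normal hulls are both orean. -/
def StronglyOrean (F : OreanForm C) : Prop :=
  F.conormalHull.IsOrean ∧ F.normalHull.IsOrean

/-- `T` is the conormal interior of `S` (largest conormal cluster below `S`). -/
def IsConormalInterior (F : OreanForm C) {X : C} (S T : F.Cl X) : Prop :=
  F.Conormal T ∧ F.le T S ∧ ∀ T' : F.Cl X, F.Conormal T' → F.le T' S → F.le T' T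

/-- `T` is the conormal exterior of `S` (smallest conormal cluster above `S`). -/
def IsConormalExterior (F : OreanForm C) {X : C} (S T : F.Cl X) : Prop :=
  F.Conormal T ∧ F.le S T ∧ ∀ T' : F.Cl X, F.Conormal T' → F.le S T' → F.le T T'

/-- `T` is the normal interior of `S` (largest normal cluster below `S`). -/
def IsNormalInterior (F : OreanForm C) {X : C} (S T : F.Cl X) : Prop :=
  F.Normal T ∧ F.le T S ∧ ∀ T' : F.Cl X, F.Normal T' → F.le T' S → F.le T' T

/-- `T` is the normal exterior of `S` (smallest normal cluster above `S`). -/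
def IsNormalExterior (F : OreanForm C) {X : C} (S T : F.Cl X) : Prop :=
  F.Normal T ∧ F.le S T ∧ ∀ T' : F.Cl X, F.Normal T' → F.le S T' → F.le T T'

/-- Componentwise product of orean forms. -/
def prod (F G : OreanForm C) : OreanForm C where
  toForm := F.toForm.prod G.toForm
  bot X := (F.bot X, G.bot X)
  top X := (F.top X, G.top X)
  join A B := (F.join A.1 B.1, G.join A.2 B.2)
  meet A B := (F.meet A.1 B.1, G.meet A.2 B.2)
  dimg f S := (F.dimg f S.1, G.dimg f S.2)
  iimg f T := (F.iimg f T.1, G.iimg f T.2)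
  bot_le A := ⟨F.bot_le A.1, G.bot_le A.2⟩
  le_top A := ⟨F.le_top A.1, G.le_top A.2⟩
  le_join_left A B := ⟨F.le_join_left A.1 B.1, G.le_join_left A.2 B.2⟩
  le_join_right A B := ⟨F.le_join_right A.1 B.1, G.le_join_right A.2 B.2⟩
  join_le h h' := ⟨F.join_le h.1 h'.1, G.join_le h.2 h'.2⟩
  meet_le_left A B := ⟨F.meet_le_left A.1 B.1, G.meet_le_left A.2 B.2⟩
  meet_le_right A B := ⟨F.meet_le_right A.1 B.1, G.meet_le_right A.2 B.2⟩
  le_meet h h' := ⟨F.le_meet h.1 h'.1, G.le_meet h.2 h'.2⟩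
  rel_dimg f S := ⟨F.rel_dimg f S.1, G.rel_dimg f S.2⟩
  dimg_le h := ⟨F.dimg_le h.1, G.dimg_le h.2⟩
  iimg_rel f T := ⟨F.iimg_rel f T.1, G.iimg_rel f T.2⟩
  le_iimg h := ⟨F.le_iimg h.1, G.le_iimg h.2⟩
  rel_decomp h := by
    obtain ⟨B1, h1, h1'⟩ := F.rel_decomp h.1
    obtain ⟨B2, h2, h2'⟩ := G.rel_decomp h.2
    exact ⟨(B1, B2), ⟨h1, h2⟩, ⟨h1', h2'⟩⟩

end OreanForm

/-- An orean factorization, stated for orean forms. -/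
def OreanFactorization {C : Type u} [Category.{v} C] (Fs Fe : OreanForm C) : Prop :=
  Fs.IsConormalForm ∧ Fe.IsNormalForm ∧
  ∀ {X Y : C} (f : X ⟶ Y), ∃ (I : C) (e : X ⟶ I) (m : I ⟶ Y),
    Fe.IsQuotient e (Fe.Ker f) ∧ Fs.IsEmbedding m (Fs.Im f) ∧ e ≫ m = f

/-- A conormal operator between orean forms (preserves images). -/
def OpConormal {C : Type u} [Category.{v} C] {Fs Fe : OreanForm C}
    (α : Operator Fs.toForm Fe.toForm) : Prop :=
  ∀ {W X : C} (f : W ⟶ X), α.app (Fs.Im f) = Fe.Im f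

/-- A normal operator between orean forms (preserves kernels). -/
def OpNormal {C : Type u} [Category.{v} C] {Fs Fe : OreanForm C}
    (β : Operator Fs.toForm Fe.toForm) : Prop :=
  ∀ {X Y : C} (g : X ⟶ Y), β.app (Fs.Ker g) = Fe.Ker g

/-- `W` is the Wyler join `A ∗ R = (π_R ·ˢ A) ·ˢ π_R` relative to an orean
factorization `(Fs, Fe)`. -/
def WylerJoin {C : Type u} [Category.{v} C] (Fs Fe : OreanForm C) {X : C}
    (A : Fs.Cl X) (R : Fe.Cl X) (W : Fs.Cl X) : Prop :=
  ∃ (Q : C) (p : X ⟶ Q), Fe.IsQuotient p R ∧ Fs.iimg p (Fs.dimg p A) = W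

section Decomp

variable {C : Type u} [Category.{v} C]

/-- Core of a decomposition: a pair of idempotent operators whose subforms of fixed
clusters are a conormal orean form resp. a normal orean form. -/
def IsDecompCore (F : OreanForm C) (κs κe : Operator F.toForm F.toForm) : Prop :=
  (∀ {X : C} (A : F.Cl X), κs.app (κs.app A) = κs.app A) ∧
  (∀ {X : C} (A : F.Cl X), κe.app (κe.app A) = κe.app A) ∧
  (F.toForm.fixedSubform κs).IsOrean ∧ (F.toForm.fixedSubform κs).IsConormal ∧
  (F.toForm.fixedSubform κe).IsOrean ∧ (F.toForm.fixedSubform κe).IsNormal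

def JoinEq (F : OreanForm C) (κs κe : Operator F.toForm F.toForm) : Prop :=
  ∀ {X : C} (S : F.Cl X), S = F.join (κs.app S) (κe.app S)

def MeetEq (F : OreanForm C) (κs κe : Operator F.toForm F.toForm) : Prop :=
  ∀ {X : C} (S : F.Cl X), S = F.meet (κs.app S) (κe.app S)

def LeftEq (F : OreanForm C) (κs : Operator F.toForm F.toForm) : Prop :=
  ∀ {X : C} (S : F.Cl X), S = κs.app S

def RightEq (F : OreanForm C) (κe : Operator F.toForm F.toForm) : Prop :=
  ∀ {X : C} (S : F.Cl X), S = κe.app S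

def TopEq (F : OreanForm C) : Prop := ∀ {X : C} (S : F.Cl X), S = F.top X

def BotEq (F : OreanForm C) : Prop := ∀ {X : C} (S : F.Cl X), S = F.bot X

/-- A decomposition of an orean form: the decomposing term is one of the six
binary bounded-lattice terms. -/
def IsDecomp (F : OreanForm C) (κs κe : Operator F.toForm F.toForm) : Prop :=
  IsDecompCore F κs κe ∧
  (JoinEq F κs κe ∨ MeetEq F κs κe ∨ LeftEq F κs ∨ RightEq F κe ∨ TopEq F ∨ BotEq F)

def IsJoinDecomp (F : OreanForm C) (κs κe : Operator F.toForm F.toForm) : Prop :=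
  IsDecompCore F κs κe ∧ JoinEq F κs κe

def IsMeetDecomp (F : OreanForm C) (κs κe : Operator F.toForm F.toForm) : Prop :=
  IsDecompCore F κs κe ∧ MeetEq F κs κe

def IsLeftDecomp (F : OreanForm C) (κs κe : Operator F.toForm F.toForm) : Prop :=
  IsDecompCore F κs κe ∧ LeftEq F κs

def IsRightDecomp (F : OreanForm C) (κs κe : Operator F.toForm F.toForm) : Prop :=
  IsDecompCore F κs κe ∧ RightEq F κe

/-- A semiexact decomposition: the decomposition projections are binormal and the pair
of fixed subforms is a semiexact pair. -/
def IsSemiexact (F : OreanForm C) (κs κe : Operator F.toForm F.toForm) : Prop :=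
  (∃ τs : Operator F.toForm (F.toForm.fixedSubform κs),
      (∀ {X : C} (A : F.Cl X), (τs.app A).1 = κs.app A) ∧ τs.Conormal ∧ τs.Normal) ∧
  (∃ τe : Operator F.toForm (F.toForm.fixedSubform κe),
      (∀ {X : C} (A : F.Cl X), (τe.app A).1 = κe.app A) ∧ τe.Conormal ∧ τe.Normal) ∧
  IsSemiexactPair (F.toForm.fixedSubform κs) (F.toForm.fixedSubform κe)

/-- An exact decomposition: semiexact, and the subform inclusions are
conormal resp. normal. -/
def IsExact (F : OreanForm C) (κs κe : Operator F.toForm F.toForm) : Prop :=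
  IsSemiexact F κs κe ∧
  (F.toForm.subformIncl (fun _ A => κs.app A = A)).Conormal ∧
  (F.toForm.subformIncl (fun _ A => κe.app A = A)).Normal

end Decomp

namespace IsoHull

variable {C : Type u} [Category.{v} C]

theorem rel_le {F : Form C} {X Y : C} {f : X ⟶ Y} {A : F.Cl X} {B D : F.Cl Y}
    (h : F.Rel f A B) (h' : F.Rel (𝟙 Y) B D) : F.Rel f A D := by
  have := F.rel_comp h h'
  rwa [Category.comp_id] at this

theorem le_rel {F : Form C} {X Y : C} {f : X ⟶ Y} {A B : F.Cl X} {D : F.Cl Y}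
    (h : F.Rel (𝟙 X) A B) (h' : F.Rel f B D) : F.Rel f A D := by
  have := F.rel_comp h h'
  rwa [Category.id_comp] at this

theorem image_unique {F : Form C} {W X : C} {f : W ⟶ X} {S T : F.Cl X}
    (hS : F.IsImageOf S f) (hT : F.IsImageOf T f) : S = T := by
  obtain ⟨t, ht, h1, h2⟩ := hS
  obtain ⟨t', ht', h1', h2'⟩ := hT
  exact F.rel_antisymm (h2 _ (le_rel (ht' t) h1')) (h2' _ (le_rel (ht t') h1))

theorem kernel_unique {F : Form C} {X Y : C} {g : X ⟶ Y} {S T : F.Cl X}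
    (hS : F.IsKernelOf S g) (hT : F.IsKernelOf T g) : S = T := by
  obtain ⟨b, hb, h1, h2⟩ := hS
  obtain ⟨b', hb', h1', h2'⟩ := hT
  exact F.rel_antisymm (h2' _ (rel_le h1 (hb b'))) (h2 _ (rel_le h1' (hb' b)))

/-- `e` is an isomorphism of forms. -/
def Iso (F G : Form C) (e : ∀ X : C, F.Cl X ≃ G.Cl X) : Prop :=
  ∀ {X Y : C} (f : X ⟶ Y) (A : F.Cl X) (B : F.Cl Y),
      F.Rel f A B ↔ G.Rel f (e X A) (e Y B)

theorem Iso.image {F G : Form C} {e : ∀ X : C, F.Cl X ≃ G.Cl X} (he : Iso F G e)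
    {W X : C} {f : W ⟶ X} {S : F.Cl X} (hS : F.IsImageOf S f) : G.IsImageOf (e X S) f := by
  obtain ⟨t, ht, h1, h2⟩ := hS
  refine ⟨e W t, fun A => ?_, (he _ _ _).1 h1, fun T hT => ?_⟩
  · obtain ⟨A, rfl⟩ := (e W).surjective A
    exact (he _ _ _).1 (ht A)
  · obtain ⟨T, rfl⟩ := (e X).surjective T
    exact (he _ _ _).1 (h2 T ((he _ _ _).2 hT))

theorem Iso.kernel {F G : Form C} {e : ∀ X : C, F.Cl X ≃ G.Cl X} (he : Iso F G e)
    {X Y : C} {g : X ⟶ Y} {S : F.Cl X} (hS : F.IsKernelOf S g) : G.IsKernelOf (e X S) g := by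
  obtain ⟨b, hb, h1, h2⟩ := hS
  refine ⟨e Y b, fun A => ?_, (he _ _ _).1 h1, fun T hT => ?_⟩
  · obtain ⟨A, rfl⟩ := (e Y).surjective A
    exact (he _ _ _).1 (hb A)
  · obtain ⟨T, rfl⟩ := (e X).surjective T
    exact (he _ _ _).1 (h2 T ((he _ _ _).2 hT))

theorem isImage_Im (F : OreanForm C) {W X : C} (f : W ⟶ X) :
    F.toForm.IsImageOf (F.Im f) f :=
  ⟨F.top W, fun A => F.le_top A, F.rel_dimg _ _, fun _ h => F.dimg_le h⟩

theorem isKernel_Ker (F : OreanForm C) {X Y : C} (f : X ⟶ Y) :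
    F.toForm.IsKernelOf (F.Ker f) f :=
  ⟨F.bot Y, fun A => F.bot_le A, F.iimg_rel _ _, fun _ h => F.le_iimg h⟩

theorem normal_bot (F : OreanForm C) (X : C) : F.Normal (F.bot X) :=
  ⟨X, 𝟙 X, F.rel_antisymm (F.iimg_rel _ _) (F.bot_le _)⟩

theorem conormal_top (F : OreanForm C) (X : C) : F.Conormal (F.top X) :=
  ⟨X, 𝟙 X, F.rel_antisymm (F.le_top _) (F.rel_dimg _ _)⟩

theorem hull_image (F : OreanForm C) {W X : C} (f : W ⟶ X) :
    F.conormalHull.IsImageOf (⟨F.Im f, W, f, rfl⟩ : F.conormalHull.Cl X) f :=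
  ⟨⟨F.top W, conormal_top F W⟩, fun A => F.le_top A.1, F.rel_dimg f (F.top W),
    fun T h => F.dimg_le (T := T.1) h⟩

theorem hull_kernel (F : OreanForm C) {X Y : C} (f : X ⟶ Y) :
    F.normalHull.IsKernelOf (⟨F.Ker f, Y, f, rfl⟩ : F.normalHull.Cl X) f :=
  ⟨⟨F.bot Y, normal_bot F Y⟩, fun A => F.bot_le A.1, F.iimg_rel f (F.bot Y),
    fun T h => F.le_iimg (S := T.1) h⟩

theorem Im_comp (F : OreanForm C) {W X Y : C} (h : W ⟶ X) (g : X ⟶ Y) :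
    F.Im (h ≫ g) = F.dimg g (F.Im h) := by
  apply F.rel_antisymm
  · exact F.dimg_le (F.rel_comp (F.rel_dimg _ _) (F.rel_dimg _ _))
  · apply F.dimg_le
    obtain ⟨B, h1, h2⟩ := F.rel_decomp (F.rel_dimg (h ≫ g) (F.top W))
    exact le_rel (F.dimg_le h1) h2

theorem rel_iimg_iff (F : OreanForm C) {X Y Z : C} (f : X ⟶ Y) (g : Y ⟶ Z) (A : F.Cl X)
    (D : F.Cl Z) : F.Rel f A (F.iimg g D) ↔ F.Rel (f ≫ g) A D := by
  constructor
  · intro h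
    exact F.rel_comp h (F.iimg_rel _ _)
  · intro h
    obtain ⟨B, h1, h2⟩ := F.rel_decomp h
    exact rel_le h1 (F.le_iimg h2)

theorem rel_join_iff (F : OreanForm C) {X Y : C} (f : X ⟶ Y) (A B : F.Cl X)
    (D : F.Cl Y) : F.Rel f (F.join A B) D ↔ F.Rel f A D ∧ F.Rel f B D := by
  constructor
  · intro h
    exact ⟨le_rel (F.le_join_left _ _) h, le_rel (F.le_join_right _ _) h⟩
  · rintro ⟨h1, h2⟩
    exact le_rel (F.join_le (F.le_iimg h1) (F.le_iimg h2)) (F.iimg_rel f D)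

/-- The consequences of noetherianness and the existence of an exact join decomposition
that are used below. -/
structure Data (F : OreanForm C) : Prop where
  n1 : ∀ {X Y W : C} (g : X ⟶ Y) (h : W ⟶ X),
    F.join (F.Im h) (F.Ker g) = F.iimg g (F.Im (h ≫ g))
  dec : ∀ {X : C} (S : F.Cl X), ∃ A R, F.Conormal A ∧ F.Normal R ∧ S = F.join A R
  int : ∀ {W X : C} (h : W ⟶ X), ∃ N : F.normalHull.Cl X, F.normalHull.IsImageOf N h ∧
    ∀ {Y : C} (f : Y ⟶ X) (R : F.normalHull.Cl Y),
      F.Rel f R.1 (F.Im h) ↔ F.normalHull.Rel f R N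

theorem data (F : OreanForm C) (hF : F.IsNoetherian)
    (hFd : ∃ κs κe : Operator F.toForm F.toForm, IsJoinDecomp F κs κe ∧ IsExact F κs κe) :
    Data F := by
  obtain ⟨κs, κe, ⟨⟨ids, ide, -, cns, -, nne⟩, hj⟩, ⟨⟨-, ⟨τe, hτe, hτc, hτn⟩, -⟩, hic, hin⟩⟩ := hFd
  have hs : ∀ {X : C} (A : F.Cl X), κs.app A = A → F.Conormal A := by
    intro X A hA
    obtain ⟨W, f, hf⟩ := cns X ⟨A, hA⟩
    exact ⟨W, f, image_unique (isImage_Im F f) (hic f _ hf)⟩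
  have he : ∀ {X : C} (A : F.Cl X), κe.app A = A → F.Normal A := by
    intro X A hA
    obtain ⟨W, f, hf⟩ := nne X ⟨A, hA⟩
    exact ⟨W, f, kernel_unique (isKernel_Ker F f) (hin f _ hf)⟩
  have he' : ∀ {X : C} (A : F.Cl X), F.Normal A → κe.app A = A := by
    rintro X A ⟨Y, g, rfl⟩
    have := hin g _ (hτn g _ (isKernel_Ker F g))
    rw [← hτe]
    exact kernel_unique this (isKernel_Ker F g)
  refine ⟨?_, ?_, ?_⟩
  · intro X Y W g h
    rw [Im_comp, (hF.1 g).1]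
  · intro X S
    exact ⟨κs.app S, κe.app S, hs _ (ids S), he _ (ide S), hj S⟩
  · intro W X h
    refine ⟨⟨κe.app (F.Im h), he _ (ide _)⟩, ?_, ?_⟩
    · obtain ⟨t, ht, h1, h2⟩ := hτc h _ (isImage_Im F h)
      refine ⟨⟨t.1, he _ t.2⟩, fun A => ht ⟨A.1, he' _ A.2⟩, ?_, fun T hT => ?_⟩
      · have h1' : F.Rel h t.1 (τe.app (F.Im h)).1 := h1
        rw [hτe] at h1'
        exact h1'
      · have h2' : F.Rel (𝟙 X) (τe.app (F.Im h)).1 T.1 := h2 ⟨T.1, he' _ T.2⟩ hT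
        rw [hτe] at h2'
        exact h2'
    · intro Y f R
      constructor
      · intro hR
        have := κe.mono hR
        rw [he' _ R.2] at this
        exact this
      · intro hR
        have h1 : F.Rel f R.1 (κe.app (F.Im h)) := hR
        refine rel_le h1 ?_
        have := F.le_join_right (κs.app (F.Im h)) (κe.app (F.Im h))
        rwa [← hj] at this

section

theorem c_Im {F G : OreanForm C} {c : ∀ X : C, F.conormalHull.Cl X ≃ G.conormalHull.Cl X}
    (hc : Iso F.conormalHull G.conormalHull c)
    {W X : C} (h : W ⟶ X) :
    c X ⟨F.Im h, W, h, rfl⟩ = ⟨G.Im h, W, h, rfl⟩ :=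
  image_unique (hc.image (hull_image F h)) (hull_image G h)

theorem n_Ker {F G : OreanForm C} {n : ∀ X : C, F.normalHull.Cl X ≃ G.normalHull.Cl X}
    (hn : Iso F.normalHull G.normalHull n)
    {X Y : C} (g : X ⟶ Y) :
    n X ⟨F.Ker g, Y, g, rfl⟩ = ⟨G.Ker g, Y, g, rfl⟩ :=
  kernel_unique (hn.kernel (hull_kernel F g)) (hull_kernel G g)

theorem key {F G : OreanForm C} (dF : Data F) (dG : Data G)
    {c : ∀ X : C, F.conormalHull.Cl X ≃ G.conormalHull.Cl X}
    (hc : Iso F.conormalHull G.conormalHull c)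
    {n : ∀ X : C, F.normalHull.Cl X ≃ G.normalHull.Cl X}
    (hn : Iso F.normalHull G.normalHull n)
    {X Y : C} (f : X ⟶ Y) (A' : F.conormalHull.Cl X) (R' : F.normalHull.Cl X)
    (A : F.conormalHull.Cl Y) (R : F.normalHull.Cl Y) :
    F.Rel f (F.join A'.1 R'.1) (F.join A.1 R.1) ↔
      G.Rel f (G.join (c X A').1 (n X R').1) (G.join (c Y A).1 (n Y R).1) := by
  obtain ⟨_, W, h, rfl⟩ := A
  obtain ⟨_, Z, g, rfl⟩ := R
  rw [c_Im hc h, n_Ker hn g]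
  rw [dF.n1, dG.n1, rel_join_iff, rel_join_iff, rel_iimg_iff, rel_iimg_iff, rel_iimg_iff,
    rel_iimg_iff]
  apply and_congr
  · have := hc (f ≫ g) A' ⟨F.Im (h ≫ g), W, h ≫ g, rfl⟩
    rw [c_Im hc] at this
    exact this
  · obtain ⟨N, hN, hN'⟩ := dF.int (h ≫ g)
    obtain ⟨M, hM, hM'⟩ := dG.int (h ≫ g)
    rw [hN', hM', image_unique hM (hn.image hN)]
    exact hn _ _ _

theorem iso {F G : OreanForm C} (dF : Data F) (dG : Data G)
    {c : ∀ X : C, F.conormalHull.Cl X ≃ G.conormalHull.Cl X}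
    (hc : Iso F.conormalHull G.conormalHull c)
    {n : ∀ X : C, F.normalHull.Cl X ≃ G.normalHull.Cl X}
    (hn : Iso F.normalHull G.normalHull n) : Form.IsIsomorphic F.toForm G.toForm := by
  choose a r ha hr hj using @Data.dec _ _ F dF
  let φ : ∀ X : C, F.Cl X → G.Cl X := fun X S =>
    G.join (c X ⟨a S, ha S⟩).1 (n X ⟨r S, hr S⟩).1
  have hφ : ∀ {X Y : C} (f : X ⟶ Y) (A : F.Cl X) (B : F.Cl Y),
      F.Rel f A B ↔ G.Rel f (φ X A) (φ Y B) := by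
    intro X Y f A B
    have := key dF dG hc hn f ⟨a A, ha A⟩ ⟨r A, hr A⟩ ⟨a B, ha B⟩ ⟨r B, hr B⟩
    dsimp only at this
    rw [← hj, ← hj] at this
    exact this
  have hb : ∀ X, Function.Bijective (φ X) := by
    intro X
    constructor
    · intro A B hAB
      apply F.rel_antisymm
      · rw [hφ, hAB]; exact G.rel_id _
      · rw [hφ, hAB]; exact G.rel_id _
    · intro T
      obtain ⟨A, R, hA, hR, rfl⟩ := dG.dec T
      obtain ⟨A0, hA0⟩ := (c X).surjective ⟨A, hA⟩
      obtain ⟨R0, hR0⟩ := (n X).surjective ⟨R, hR⟩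
      refine ⟨F.join A0.1 R0.1, ?_⟩
      have k1 := key dF dG hc hn (𝟙 X) A0 R0 ⟨a (F.join A0.1 R0.1), ha _⟩
        ⟨r (F.join A0.1 R0.1), hr _⟩
      have k2 := key dF dG hc hn (𝟙 X) ⟨a (F.join A0.1 R0.1), ha _⟩
        ⟨r (F.join A0.1 R0.1), hr _⟩ A0 R0
      dsimp only at k1 k2
      rw [← hj, hA0, hR0] at k1 k2
      exact G.rel_antisymm (k2.1 (F.rel_id _)) (k1.1 (F.rel_id _))
  exact ⟨fun X => Equiv.ofBijective (φ X) (hb X), fun f A B => hφ f A B⟩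

end

theorem hulls {F G : OreanForm C} {e : ∀ X : C, F.Cl X ≃ G.Cl X}
    (he : Iso F.toForm G.toForm e) :
    Form.IsIsomorphic F.conormalHull G.conormalHull ∧
      Form.IsIsomorphic F.normalHull G.normalHull := by
  have h1 : ∀ {W X : C} (f : W ⟶ X), e X (F.Im f) = G.Im f := fun f =>
    image_unique (he.image (isImage_Im F f)) (isImage_Im G f)
  have h2 : ∀ {X Y : C} (f : X ⟶ Y), e X (F.Ker f) = G.Ker f := fun f =>
    kernel_unique (he.kernel (isKernel_Ker F f)) (isKernel_Ker G f)
  constructor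
  · refine ⟨fun X => (e X).subtypeEquiv fun A => ?_, fun f A B => he f A.1 B.1⟩
    constructor
    · rintro ⟨W, f, rfl⟩
      exact ⟨W, f, (h1 f).symm⟩
    · rintro ⟨W, f, h⟩
      exact ⟨W, f, (e X).injective ((h1 f).trans h)⟩
  · refine ⟨fun X => (e X).subtypeEquiv fun A => ?_, fun f A B => he f A.1 B.1⟩
    constructor
    · rintro ⟨W, f, rfl⟩
      exact ⟨W, f, (h2 f).symm⟩
    · rintro ⟨W, f, h⟩
      exact ⟨W, f, (e X).injective ((h2 f).trans h)⟩

end IsoHull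

/-- Theorem: for noetherian forms `F`, `G` over the same category, both having exact
join decompositions, `F_c ≅ G_c` and `F_n ≅ G_n` iff `F ≅ G`. -/
theorem iso_of_hull_isos {C : Type u} [Category.{v} C]
    (F G : OreanForm C) (hF : F.IsNoetherian) (hG : G.IsNoetherian)
    (hFd : ∃ κs κe : Operator F.toForm F.toForm, IsJoinDecomp F κs κe ∧ IsExact F κs κe)
    (hGd : ∃ κs κe : Operator G.toForm G.toForm, IsJoinDecomp G κs κe ∧ IsExact G κs κe) :
    (Form.IsIsomorphic F.conormalHull G.conormalHull ∧
      Form.IsIsomorphic F.normalHull G.normalHull) ↔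
    Form.IsIsomorphic F.toForm G.toForm := by
  constructor
  · rintro ⟨⟨c, hc⟩, ⟨n, hn⟩⟩
    exact IsoHull.iso (IsoHull.data F hF hFd) (IsoHull.data G hG hGd) hc hn
  · rintro ⟨e, he⟩
    exact IsoHull.hulls he
end

section
/- An orean form F has an exact join decomposition if and only if the following three properties hold: (i) every cluster S decomposes as S = C ∨ N, where C is the largest conormal cluster below S and N is the largest normal cluster below S; (ii) for every morphism f and every cluster S in its codomain, the inverse image along f of the largest normal cluster below S is the largest normal cluster below S·f; (iii) for every morphism f, the direct image along f of the largest normal cluster in the domain of f is the largest normal cluster below Im f. Moreover, when F has an exact join decomposition, it is unique and is given by the pair of subforms (F_c, F_n); furthermore, direct images of normal clusters are then normal, joins of conormal clusters are conormal, and joins of normal clusters are normal. -/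
open CategoryTheory

universe w v u

section Helpers

variable {C : Type u} [Category.{v} C]

namespace Form

theorem rel_le (F : Form C) {X Y : C} {f : X ⟶ Y} {A : F.Cl X} {B D : F.Cl Y}
    (h : F.Rel f A B) (h' : F.Rel (𝟙 Y) B D) : F.Rel f A D := by
  have := F.rel_comp h h'
  rwa [Category.comp_id] at this

theorem le_rel (F : Form C) {X Y : C} {f : X ⟶ Y} {A B : F.Cl X} {D : F.Cl Y}
    (h : F.Rel (𝟙 X) A B) (h' : F.Rel f B D) : F.Rel f A D := by
  have := F.rel_comp h h'
  rwa [Category.id_comp] at this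

end Form

theorem of_isImageOf (F : OreanForm C) {W X : C} {S : F.Cl X} {f : W ⟶ X}
    (h : F.toForm.IsImageOf S f) : F.Im f = S := by
  obtain ⟨t, ht, h1, h2⟩ := h
  have e : t = F.top W := F.rel_antisymm (F.le_top t) (ht _)
  subst e
  exact F.rel_antisymm (F.dimg_le h1) (h2 _ (F.rel_dimg _ _))

theorem isImageOf_im (F : OreanForm C) {W X : C} (f : W ⟶ X) :
    F.toForm.IsImageOf (F.Im f) f :=
  ⟨F.top W, fun A => F.le_top A, F.rel_dimg _ _, fun _ h => F.dimg_le h⟩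

theorem of_isKernelOf (F : OreanForm C) {X Y : C} {S : F.Cl X} {g : X ⟶ Y}
    (h : F.toForm.IsKernelOf S g) : F.Ker g = S := by
  obtain ⟨t, ht, h1, h2⟩ := h
  have e : t = F.bot Y := F.rel_antisymm (ht _) (F.bot_le t)
  subst e
  exact F.rel_antisymm (h2 _ (F.iimg_rel _ _)) (F.le_iimg h1)

theorem isKernelOf_ker (F : OreanForm C) {X Y : C} (g : X ⟶ Y) :
    F.toForm.IsKernelOf (F.Ker g) g :=
  ⟨F.bot Y, fun A => F.bot_le A, F.iimg_rel _ _, fun _ h => F.le_iimg h⟩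

theorem conormal_dimg (F : OreanForm C) {X Y : C} (f : X ⟶ Y) {S : F.Cl X}
    (h : F.Conormal S) : F.Conormal (F.dimg f S) := by
  obtain ⟨W, g, rfl⟩ := h
  refine ⟨W, g ≫ f, F.rel_antisymm ?_ ?_⟩
  · exact F.dimg_le (F.rel_comp (F.rel_dimg _ _) (F.rel_dimg _ _))
  · obtain ⟨B, h1, h2⟩ := F.rel_decomp (F.rel_dimg (g ≫ f) (F.top W))
    exact F.dimg_le (F.le_rel (F.dimg_le h1) h2)

theorem normal_iimg (F : OreanForm C) {X Y : C} (f : X ⟶ Y) {S : F.Cl Y}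
    (h : F.Normal S) : F.Normal (F.iimg f S) := by
  obtain ⟨W, g, rfl⟩ := h
  refine ⟨W, f ≫ g, F.rel_antisymm ?_ ?_⟩
  · obtain ⟨B, h1, h2⟩ := F.rel_decomp (F.iimg_rel (f ≫ g) (F.bot W))
    exact F.le_iimg (F.rel_le h1 (F.le_iimg h2))
  · exact F.le_iimg (F.rel_comp (F.iimg_rel _ _) (F.iimg_rel _ _))

theorem conormal_top (F : OreanForm C) (X : C) : F.Conormal (F.top X) :=
  ⟨X, 𝟙 X, F.rel_antisymm (F.le_top _) (F.rel_dimg _ _)⟩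

/-- Fixed clusters of an interior operator form an orean form. -/
theorem fixed_isOrean (F : OreanForm C) (κ : Operator F.toForm F.toForm)
    (hle : ∀ {X : C} (A : F.Cl X), F.le (κ.app A) A)
    (hid : ∀ {X : C} (A : F.Cl X), κ.app (κ.app A) = κ.app A) :
    (F.toForm.fixedSubform κ).IsOrean := by
  have key : ∀ {X Y : C} {f : X ⟶ Y} {A : F.Cl X} {B : F.Cl Y}, κ.app A = A →
      F.Rel f A B → F.Rel f A (κ.app B) := by
    intro X Y f A B hA h
    have := κ.mono h
    rwa [hA] at this
  refine ⟨?_, ?_, ?_, ?_, ?_, ?_, ?_⟩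
  · intro X
    exact ⟨⟨F.bot X, F.rel_antisymm (hle _) (F.bot_le _)⟩, fun A => F.bot_le A.1⟩
  · intro X
    exact ⟨⟨κ.app (F.top X), hid _⟩, fun A => key A.2 (F.le_top A.1)⟩
  · intro X A B
    exact ⟨⟨F.join A.1 B.1, F.rel_antisymm (hle _)
      (F.join_le (key A.2 (F.le_join_left _ _)) (key B.2 (F.le_join_right _ _)))⟩,
      F.le_join_left _ _, F.le_join_right _ _, fun D h h' => F.join_le h h'⟩
  · intro X A B
    exact ⟨⟨κ.app (F.meet A.1 B.1), hid _⟩, F.rel_le (hle _) (F.meet_le_left _ _),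
      F.rel_le (hle _) (F.meet_le_right _ _), fun D h h' => key D.2 (F.le_meet h h')⟩
  · intro X Y f S
    exact ⟨⟨F.dimg f S.1, F.rel_antisymm (hle _) (F.dimg_le (key S.2 (F.rel_dimg _ _)))⟩,
      F.rel_dimg _ _, fun T h => F.dimg_le h⟩
  · intro X Y f T
    exact ⟨⟨κ.app (F.iimg f T.1), hid _⟩, F.le_rel (hle _) (F.iimg_rel _ _),
      fun S h => key S.2 (F.le_iimg h)⟩
  · intro X Y Z f g A D h
    obtain ⟨B, h1, h2⟩ := F.rel_decomp (f := f) (g := g) (A := A.1) (D := D.1) h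
    exact ⟨⟨κ.app B, hid _⟩, key A.2 h1, F.le_rel (hle _) h2⟩

/-- Basic consequences of having an exact join decomposition. -/
theorem exact_basic (F : OreanForm C) (κs κe : Operator F.toForm F.toForm)
    (hd : IsJoinDecomp F κs κe) (he : IsExact F κs κe) :
    (∀ {X : C} (S : F.Cl X), F.le (κs.app S) S ∧ F.le (κe.app S) S) ∧
    (∀ {X : C} (S : F.Cl X), (κs.app S = S ↔ F.Conormal S) ∧ (κe.app S = S ↔ F.Normal S)) := by
  obtain ⟨⟨ids, ide, os, cs, oe, ne⟩, hj⟩ := hd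
  obtain ⟨⟨⟨τs, hτs, τsc, τsn⟩, ⟨τe, hτe, τec, τen⟩, hp⟩, ic, inn⟩ := he
  refine ⟨fun {X} S => ⟨?_, ?_⟩, fun {X} S => ⟨⟨?_, ?_⟩, ⟨?_, ?_⟩⟩⟩
  · have := F.le_join_left (κs.app S) (κe.app S)
    rwa [← hj S] at this
  · have := F.le_join_right (κs.app S) (κe.app S)
    rwa [← hj S] at this
  · intro h
    obtain ⟨W, f, hf⟩ := cs X ⟨S, h⟩
    exact ⟨W, f, of_isImageOf F (ic f _ hf)⟩
  · rintro ⟨W, f, rfl⟩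
    have h1 := of_isImageOf F (ic f _ (τsc f _ (isImageOf_im F f)))
    have h2 : F.Im f = (τs.app (F.Im f)).1 := h1
    rw [hτs] at h2
    exact h2.symm
  · intro h
    obtain ⟨W, f, hf⟩ := ne X ⟨S, h⟩
    exact ⟨W, f, of_isKernelOf F (inn f _ hf)⟩
  · rintro ⟨W, f, rfl⟩
    have h1 := of_isKernelOf F (inn f _ (τen f _ (isKernelOf_ker F f)))
    have h2 : F.Ker f = (τe.app (F.Ker f)).1 := h1
    rw [hτe] at h2
    exact h2.symm

theorem exact_interior (F : OreanForm C) (κs κe : Operator F.toForm F.toForm)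
    (hd : IsJoinDecomp F κs κe) (he : IsExact F κs κe) {X : C} (S : F.Cl X) :
    F.IsConormalInterior S (κs.app S) ∧ F.IsNormalInterior S (κe.app S) := by
  obtain ⟨hle, hfix⟩ := exact_basic F κs κe hd he
  refine ⟨⟨(hfix _).1.1 (hd.1.1 S), (hle S).1, fun T hT h => ?_⟩,
    ⟨(hfix _).2.1 (hd.1.2.1 S), (hle S).2, fun T hT h => ?_⟩⟩
  · have := κs.mono h
    rwa [(hfix T).1.2 hT] at this
  · have := κe.mono h
    rwa [(hfix T).2.2 hT] at this

theorem conormalInterior_unique (F : OreanForm C) {X : C} {S T T' : F.Cl X}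
    (h : F.IsConormalInterior S T) (h' : F.IsConormalInterior S T') : T = T' :=
  F.rel_antisymm (h'.2.2 _ h.1 h.2.1) (h.2.2 _ h'.1 h'.2.1)

theorem normalInterior_unique (F : OreanForm C) {X : C} {S T T' : F.Cl X}
    (h : F.IsNormalInterior S T) (h' : F.IsNormalInterior S T') : T = T' :=
  F.rel_antisymm (h'.2.2 _ h.1 h.2.1) (h.2.2 _ h'.1 h'.2.1)

theorem exact_dimg_normal (F : OreanForm C) (κs κe : Operator F.toForm F.toForm)
    (hd : IsJoinDecomp F κs κe) (he : IsExact F κs κe) {X Y : C} (f : X ⟶ Y) (R : F.Cl X)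
    (hR : F.Normal R) : F.Normal (F.dimg f R) := by
  obtain ⟨hle, hfix⟩ := exact_basic F κs κe hd he
  have h := κe.mono (F.rel_dimg f R)
  rw [(hfix R).2.2 hR] at h
  exact (hfix _).2.1 (F.rel_antisymm (hle _).2 (F.dimg_le h))

theorem exact_of_conditions (F : OreanForm C)
    (h1 : ∀ {X : C} (S : F.Cl X), ∃ Cc N : F.Cl X,
          F.IsConormalInterior S Cc ∧ F.IsNormalInterior S N ∧ S = F.join Cc N)
    (h2 : ∀ {X Y : C} (f : X ⟶ Y) (S N : F.Cl Y),
          F.IsNormalInterior S N → F.IsNormalInterior (F.iimg f S) (F.iimg f N))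
    (h3 : ∀ {X Y : C} (f : X ⟶ Y) (N : F.Cl X),
          F.IsNormalInterior (F.top X) N → F.IsNormalInterior (F.Im f) (F.dimg f N)) :
    ∃ κs κe : Operator F.toForm F.toForm, IsJoinDecomp F κs κe ∧ IsExact F κs κe := by
  choose c n hc hn hj using @h1
  let κs : Operator F.toForm F.toForm :=
    { app := fun {X} S => c S
      mono := by
        intro X Y f A B h
        exact F.rel_le (F.rel_dimg f (c A)) ((hc B).2.2 _ (conormal_dimg F f (hc A).1)
          (F.dimg_le (F.le_rel (hc A).2.1 h))) }
  let κe : Operator F.toForm F.toForm :=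
    { app := fun {X} S => n S
      mono := by
        intro X Y f A B h
        exact F.le_rel ((h2 f B _ (hn B)).2.2 _ (hn A).1
          (F.rel_le (hn A).2.1 (F.le_iimg h))) (F.iimg_rel f (n B)) }
  have fs : ∀ {X : C} (S : F.Cl X), F.Conormal S → c S = S := fun S h =>
    F.rel_antisymm (hc S).2.1 ((hc S).2.2 _ h (F.rel_id S))
  have fe : ∀ {X : C} (S : F.Cl X), F.Normal S → n S = S := fun S h =>
    F.rel_antisymm (hn S).2.1 ((hn S).2.2 _ h (F.rel_id S))
  have ids : ∀ {X : C} (S : F.Cl X), κs.app (κs.app S) = κs.app S := fun S => fs _ (hc S).1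
  have ide : ∀ {X : C} (S : F.Cl X), κe.app (κe.app S) = κe.app S := fun S => fe _ (hn S).1
  have os := fixed_isOrean F κs (fun S => (hc S).2.1) ids
  have oe := fixed_isOrean F κe (fun S => (hn S).2.1) ide
  have bots : ∀ X : C, κs.app (F.bot X) = F.bot X := fun X =>
    F.rel_antisymm (hc _).2.1 (F.bot_le _)
  have bote : ∀ X : C, κe.app (F.bot X) = F.bot X := fun X =>
    F.rel_antisymm (hn _).2.1 (F.bot_le _)
  -- images and kernels in the fixed subforms
  have ims : ∀ {W X : C} (f : W ⟶ X) (A : (F.toForm.fixedSubform κs).Cl X),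
      (F.toForm.fixedSubform κs).IsImageOf A f ↔ A.1 = F.Im f := by
    intro W X f A
    have tfix : κs.app (F.top W) = F.top W := fs _ (conormal_top F W)
    constructor
    · rintro ⟨t, ht, r, m⟩
      have e : t.1 = F.top W := F.rel_antisymm (F.le_top _) (ht ⟨F.top W, tfix⟩)
      have r' : F.Rel f t.1 A.1 := r
      rw [e] at r'
      refine F.rel_antisymm (m ⟨F.Im f, fs _ ⟨W, f, rfl⟩⟩ ?_) (F.dimg_le r')
      change F.Rel f t.1 (F.Im f)
      rw [e]
      exact F.rel_dimg _ _
    · intro e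
      refine ⟨⟨F.top W, tfix⟩, fun B => F.le_top B.1, ?_, fun T h => ?_⟩
      · change F.Rel f (F.top W) A.1
        rw [e]
        exact F.rel_dimg _ _
      · change F.Rel _ A.1 T.1
        rw [e]
        exact F.dimg_le h
  have ime : ∀ {W X : C} (f : W ⟶ X) (A : (F.toForm.fixedSubform κe).Cl X),
      A.1 = n (F.Im f) → (F.toForm.fixedSubform κe).IsImageOf A f := by
    intro W X f A e
    have e' : A.1 = F.dimg f (n (F.top W)) :=
      e.trans (normalInterior_unique F (hn _) (h3 f _ (hn (F.top W))))
    refine ⟨⟨n (F.top W), ide _⟩, fun B => ?_, ?_, fun T h => ?_⟩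
    · have := κe.mono (F.le_top B.1)
      rwa [B.2] at this
    · change F.Rel f (n (F.top W)) A.1
      rw [e']
      exact F.rel_dimg _ _
    · change F.Rel _ A.1 T.1
      rw [e']
      exact F.dimg_le h
  have kes : ∀ {X Y : C} (g : X ⟶ Y) (A : (F.toForm.fixedSubform κs).Cl X),
      A.1 = c (F.Ker g) → (F.toForm.fixedSubform κs).IsKernelOf A g := by
    intro X Y g A e
    refine ⟨⟨F.bot Y, bots Y⟩, fun B => F.bot_le B.1, ?_, fun T h => ?_⟩
    · change F.Rel g A.1 (F.bot Y)
      rw [e]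
      exact F.le_rel (hc _).2.1 (F.iimg_rel _ _)
    · change F.Rel _ T.1 A.1
      rw [e]
      have := κs.mono (F.le_iimg (f := g) (S := T.1) (T := F.bot Y) h)
      rwa [T.2] at this
  have kee : ∀ {X Y : C} (g : X ⟶ Y) (A : (F.toForm.fixedSubform κe).Cl X),
      (F.toForm.fixedSubform κe).IsKernelOf A g ↔ A.1 = F.Ker g := by
    intro X Y g A
    constructor
    · rintro ⟨t, ht, r, m⟩
      have e : t.1 = F.bot Y := F.rel_antisymm (ht ⟨F.bot Y, bote Y⟩) (F.bot_le _)
      have r' : F.Rel g A.1 t.1 := r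
      rw [e] at r'
      refine F.rel_antisymm (F.le_iimg r') (m ⟨F.Ker g, fe _ ⟨Y, g, rfl⟩⟩ ?_)
      change F.Rel g (F.Ker g) t.1
      rw [e]
      exact F.iimg_rel _ _
    · intro e
      refine ⟨⟨F.bot Y, bote Y⟩, fun B => F.bot_le B.1, ?_, fun T h => ?_⟩
      · change F.Rel g A.1 (F.bot Y)
        rw [e]
        exact F.iimg_rel _ _
      · change F.Rel _ T.1 A.1
        rw [e]
        exact F.le_iimg h
  have cs : (F.toForm.fixedSubform κs).IsConormal := by
    intro X S
    have hS : F.Conormal S.1 := by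
      have := (hc S.1).1
      rwa [show c S.1 = S.1 from S.2] at this
    obtain ⟨W, f, hf⟩ := hS
    exact ⟨W, f, (ims f S).2 hf.symm⟩
  have ne : (F.toForm.fixedSubform κe).IsNormal := by
    intro X S
    have hS : F.Normal S.1 := by
      have := (hn S.1).1
      rwa [show n S.1 = S.1 from S.2] at this
    obtain ⟨W, f, hf⟩ := hS
    exact ⟨W, f, (kee f S).2 hf.symm⟩
  refine ⟨κs, κe, ⟨⟨ids, ide, os, cs, oe, ne⟩, fun S => hj S⟩, ⟨⟨?_, ?_, ?_⟩, ?_, ?_⟩⟩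
  · refine ⟨⟨fun A => ⟨κs.app A, ids A⟩, fun h => κs.mono h⟩, fun A => rfl, ?_, ?_⟩
    · intro W X f S h
      have := of_isImageOf F h
      subst this
      exact (ims f _).2 (fs _ ⟨W, f, rfl⟩)
    · intro X Y g S h
      have := of_isKernelOf F h
      subst this
      exact kes g _ rfl
  · refine ⟨⟨fun A => ⟨κe.app A, ide A⟩, fun h => κe.mono h⟩, fun A => rfl, ?_, ?_⟩
    · intro W X f S h
      have := of_isImageOf F h
      subst this
      exact ime f _ rfl
    · intro X Y g S h
      have := of_isKernelOf F h
      subst this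
      exact (kee g _).2 (fe _ ⟨Y, g, rfl⟩)
  · refine ⟨os, cs, oe, ne, ⟨⟨fun A => ⟨κe.app A.1, ide _⟩, fun h => κe.mono h⟩, ?_⟩,
      ⟨⟨fun A => ⟨κs.app A.1, ids _⟩, fun h => κs.mono h⟩, ?_⟩⟩
    · intro W X f S h
      exact ime f _ (congrArg n ((ims f S).1 h))
    · intro X Y g S h
      exact kes g _ (congrArg c ((kee g S).1 h))
  · intro W X f S h
    change F.toForm.IsImageOf S.1 f
    rw [(ims f S).1 h]
    exact isImageOf_im F f
  · intro X Y g S h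
    change F.toForm.IsKernelOf S.1 g
    rw [(kee g S).1 h]
    exact isKernelOf_ker F g

end Helpers

/-- Theorem: an orean form `F` has an exact join decomposition iff (i) every cluster is
the join of its conormal interior and its normal interior, (ii) inverse images of
normal interiors are normal interiors of inverse images, (iii) direct images of the
normal interior of the top cluster are normal interiors of images. Moreover an exact
join decomposition is unique, is given by the pair of subforms `(F_c, F_n)` (the fixed
clusters of `κ_s`/`κ_e` are exactly the conormal/normal clusters), and then direct
images of normal clusters are normal, joins of conormal clusters are conormal, and
joins of normal clusters are normal. -/
theorem exact_join_decomposition_characterization {C : Type u} [Category.{v} C]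
    (F : OreanForm C) :
    ((∃ κs κe : Operator F.toForm F.toForm, IsJoinDecomp F κs κe ∧ IsExact F κs κe) ↔
      ((∀ {X : C} (S : F.Cl X), ∃ Cc N : F.Cl X,
          F.IsConormalInterior S Cc ∧ F.IsNormalInterior S N ∧ S = F.join Cc N) ∧
        (∀ {X Y : C} (f : X ⟶ Y) (S N : F.Cl Y),
          F.IsNormalInterior S N → F.IsNormalInterior (F.iimg f S) (F.iimg f N)) ∧
        (∀ {X Y : C} (f : X ⟶ Y) (N : F.Cl X),
          F.IsNormalInterior (F.top X) N → F.IsNormalInterior (F.Im f) (F.dimg f N)))) ∧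
    (∀ κs κe κs' κe' : Operator F.toForm F.toForm,
      IsJoinDecomp F κs κe → IsExact F κs κe → IsJoinDecomp F κs' κe' → IsExact F κs' κe' →
      ∀ {X : C} (S : F.Cl X), κs.app S = κs'.app S ∧ κe.app S = κe'.app S) ∧
    (∀ κs κe : Operator F.toForm F.toForm, IsJoinDecomp F κs κe → IsExact F κs κe →
      ∀ {X : C} (S : F.Cl X), (κs.app S = S ↔ F.Conormal S) ∧ (κe.app S = S ↔ F.Normal S)) ∧
    ((∃ κs κe : Operator F.toForm F.toForm, IsJoinDecomp F κs κe ∧ IsExact F κs κe) →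
      (∀ {X Y : C} (f : X ⟶ Y) (R : F.Cl X), F.Normal R → F.Normal (F.dimg f R)) ∧
      (∀ {X : C} (S T : F.Cl X), F.Conormal S → F.Conormal T → F.Conormal (F.join S T)) ∧
      (∀ {X : C} (S T : F.Cl X), F.Normal S → F.Normal T → F.Normal (F.join S T))) := by
  refine ⟨⟨?_, ?_⟩, ?_, ?_, ?_⟩
  · rintro ⟨κs, κe, hd, he⟩
    have hint := fun {X : C} (S : F.Cl X) => exact_interior F κs κe hd he S
    refine ⟨?_, ?_, ?_⟩
    · intro X S
      exact ⟨κs.app S, κe.app S, (hint S).1, (hint S).2, hd.2 S⟩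
    · intro X Y f S N hN
      have e : N = κe.app S := normalInterior_unique F hN (hint S).2
      refine ⟨normal_iimg F f hN.1, F.le_iimg (F.rel_le (F.iimg_rel _ _) hN.2.1), ?_⟩
      intro T hT hTS
      have h := κe.mono (F.le_rel hTS (F.iimg_rel f S))
      rw [((exact_basic F κs κe hd he).2 T).2.2 hT] at h
      rw [e]
      exact F.le_iimg h
    · intro X Y f N hN
      refine ⟨exact_dimg_normal F κs κe hd he f N hN.1,
        F.dimg_le (F.le_rel hN.2.1 (F.rel_dimg _ _)), ?_⟩
      intro T hT hTS
      have e : N = κe.app (F.top X) := normalInterior_unique F hN (hint _).2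
      have hle : F.Rel (𝟙 Y) (κe.app (F.Im f)) (F.dimg f N) := by
        have hnorm := exact_dimg_normal F κs κe hd he f N hN.1
        have hfix := ((exact_basic F κs κe hd he).2 (F.dimg f N)).2.2 hnorm
        obtain ⟨⟨_, ⟨τe, hτe, τec, _⟩, _⟩, _, _⟩ := he
        obtain ⟨t, ht, r, m⟩ := τec f _ (isImageOf_im F f)
        have et : F.Rel (𝟙 X) t.1 N := by
          have := κe.mono (F.le_top t.1)
          rw [t.2, ← e] at this
          exact this
        have h : F.Rel (𝟙 Y) (τe.app (F.Im f)).1 (F.dimg f N) :=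
          m ⟨F.dimg f N, hfix⟩ (F.le_rel et (F.rel_dimg f N))
        rwa [hτe] at h
      exact F.rel_le ((hint (F.Im f)).2.2.2 T hT hTS) hle
  · rintro ⟨h1, h2, h3⟩
    exact exact_of_conditions F h1 h2 h3
  · intro κs κe κs' κe' hd he hd' he' X S
    exact ⟨conormalInterior_unique F (exact_interior F κs κe hd he S).1
        (exact_interior F κs' κe' hd' he' S).1,
      normalInterior_unique F (exact_interior F κs κe hd he S).2
        (exact_interior F κs' κe' hd' he' S).2⟩
  · intro κs κe hd he
    exact (exact_basic F κs κe hd he).2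
  · rintro ⟨κs, κe, hd, he⟩
    obtain ⟨hle, hfix⟩ := exact_basic F κs κe hd he
    refine ⟨exact_dimg_normal F κs κe hd he, ?_, ?_⟩
    · intro X S T hS hT
      have a := κs.mono (F.le_join_left S T)
      have b := κs.mono (F.le_join_right S T)
      rw [(hfix _).1.2 hS] at a
      rw [(hfix _).1.2 hT] at b
      exact (hfix _).1.1 (F.rel_antisymm (hle _).1 (F.join_le a b))
    · intro X S T hS hT
      have a := κe.mono (F.le_join_left S T)
      have b := κe.mono (F.le_join_right S T)
      rw [(hfix _).2.2 hS] at a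
      rw [(hfix _).2.2 hT] at b
      exact (hfix _).2.1 (F.rel_antisymm (hle _).2 (F.join_le a b))
end

section
/- For an orean form F : B → C, the following conditions are equivalent: (i) F is binormal; (ii) the pair of identity operators (1_B, 1_B) is an exact decomposition of F which is simultaneously a left, right, meet and join decomposition; (iii) F has a left decomposition as well as a right decomposition; (iv) F has an exact join decomposition and an exact meet decomposition; (v) (1_B, 1_B) is a decomposition of F. Moreover, when F is binormal, (1_B, 1_B) is the only decomposition of F that is both a left and a right decomposition, and it is the only exact decomposition of F. -/
open CategoryTheory

universe w v u

namespace BinormalAux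

variable {C : Type u} [Category.{v} C]

theorem isImageOf_Im (F : OreanForm C) {W X : C} (f : W ⟶ X) :
    F.toForm.IsImageOf (F.Im f) f :=
  ⟨F.top W, fun A => F.le_top A, F.rel_dimg f _, fun _ h => F.dimg_le h⟩

theorem isKernelOf_Ker (F : OreanForm C) {X Y : C} (g : X ⟶ Y) :
    F.toForm.IsKernelOf (F.Ker g) g :=
  ⟨F.bot Y, fun A => F.bot_le A, F.iimg_rel g _, fun _ h => F.le_iimg h⟩

theorem image_unique (F : Form C) {W X : C} {f : W ⟶ X} {S T : F.Cl X}
    (hS : F.IsImageOf S f) (hT : F.IsImageOf T f) : S = T := by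
  obtain ⟨t, ht, h1, h2⟩ := hS
  obtain ⟨t', ht', h1', h2'⟩ := hT
  have e : t = t' := F.rel_antisymm (ht' t) (ht t')
  subst e
  exact F.rel_antisymm (h2 _ h1') (h2' _ h1)

theorem kernel_unique (F : Form C) {X Y : C} {g : X ⟶ Y} {S T : F.Cl X}
    (hS : F.IsKernelOf S g) (hT : F.IsKernelOf T g) : S = T := by
  obtain ⟨t, ht, h1, h2⟩ := hS
  obtain ⟨t', ht', h1', h2'⟩ := hT
  have e : t = t' := F.rel_antisymm (ht t') (ht' t)
  subst e
  exact F.rel_antisymm (h2' _ h1) (h2 _ h1')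

theorem isOrean (F : OreanForm C) : F.toForm.IsOrean :=
  ⟨fun X => ⟨F.bot X, fun A => F.bot_le A⟩, fun X => ⟨F.top X, fun A => F.le_top A⟩,
    fun _ A B => ⟨F.join A B, F.le_join_left A B, F.le_join_right A B, fun _ h h' => F.join_le h h'⟩,
    fun _ A B => ⟨F.meet A B, F.meet_le_left A B, F.meet_le_right A B, fun _ h h' => F.le_meet h h'⟩,
    fun f S => ⟨F.dimg f S, F.rel_dimg f S, fun _ h => F.dimg_le h⟩,
    fun f T => ⟨F.iimg f T, F.iimg_rel f T, fun _ h => F.le_iimg h⟩,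
    fun _ _ _ _ h => F.rel_decomp h⟩

theorem isConormal_iff (F : OreanForm C) : F.toForm.IsConormal ↔ F.IsConormalForm := by
  constructor
  · intro h X S
    obtain ⟨W, f, hf⟩ := h X S
    exact ⟨W, f, image_unique _ (isImageOf_Im F f) hf⟩
  · intro h X S
    obtain ⟨W, f, rfl⟩ := h S
    exact ⟨W, f, isImageOf_Im F f⟩

theorem isNormal_iff (F : OreanForm C) : F.toForm.IsNormal ↔ F.IsNormalForm := by
  constructor
  · intro h X S
    obtain ⟨W, f, hf⟩ := h X S
    exact ⟨W, f, kernel_unique _ (isKernelOf_Ker F f) hf⟩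
  · intro h X S
    obtain ⟨W, f, rfl⟩ := h S
    exact ⟨W, f, isKernelOf_Ker F f⟩

theorem fixed_image (F : Form C) (κ : Operator F F) (hκ : ∀ (X : C) (A : F.Cl X), κ.app A = A)
    {W X : C} (f : W ⟶ X) (S : (F.fixedSubform κ).Cl X) :
    (F.fixedSubform κ).IsImageOf S f ↔ F.IsImageOf S.1 f := by
  constructor
  · rintro ⟨t, ht, h1, h2⟩
    exact ⟨t.1, fun A => ht ⟨A, hκ _ A⟩, h1, fun T h => h2 ⟨T, hκ _ T⟩ h⟩
  · rintro ⟨t, ht, h1, h2⟩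
    exact ⟨⟨t, hκ _ t⟩, fun A => ht A.1, h1, fun T h => h2 T.1 h⟩

theorem fixed_kernel (F : Form C) (κ : Operator F F) (hκ : ∀ (X : C) (A : F.Cl X), κ.app A = A)
    {X Y : C} (f : X ⟶ Y) (S : (F.fixedSubform κ).Cl X) :
    (F.fixedSubform κ).IsKernelOf S f ↔ F.IsKernelOf S.1 f := by
  constructor
  · rintro ⟨t, ht, h1, h2⟩
    exact ⟨t.1, fun A => ht ⟨A, hκ _ A⟩, h1, fun T h => h2 ⟨T, hκ _ T⟩ h⟩
  · rintro ⟨t, ht, h1, h2⟩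
    exact ⟨⟨t, hκ _ t⟩, fun A => ht A.1, h1, fun T h => h2 T.1 h⟩

theorem fixed_conormal (F : OreanForm C) (κ : Operator F.toForm F.toForm)
    (hκ : ∀ (X : C) (A : F.Cl X), κ.app A = A) :
    (F.toForm.fixedSubform κ).IsConormal ↔ F.IsConormalForm := by
  rw [← isConormal_iff]
  constructor
  · intro h X S
    obtain ⟨W, f, hf⟩ := h X ⟨S, hκ _ S⟩
    exact ⟨W, f, (fixed_image _ κ hκ f _).1 hf⟩
  · intro h X S
    obtain ⟨W, f, hf⟩ := h X S.1
    exact ⟨W, f, (fixed_image _ κ hκ f _).2 hf⟩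

theorem fixed_normal (F : OreanForm C) (κ : Operator F.toForm F.toForm)
    (hκ : ∀ (X : C) (A : F.Cl X), κ.app A = A) :
    (F.toForm.fixedSubform κ).IsNormal ↔ F.IsNormalForm := by
  rw [← isNormal_iff]
  constructor
  · intro h X S
    obtain ⟨W, f, hf⟩ := h X ⟨S, hκ _ S⟩
    exact ⟨W, f, (fixed_kernel _ κ hκ f _).1 hf⟩
  · intro h X S
    obtain ⟨W, f, hf⟩ := h X S.1
    exact ⟨W, f, (fixed_kernel _ κ hκ f _).2 hf⟩

theorem fixed_orean (F : OreanForm C) : (F.toForm.fixedSubform F.toForm.idOp).IsOrean := by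
  refine ⟨fun X => ⟨⟨F.bot X, rfl⟩, fun A => F.bot_le A.1⟩,
    fun X => ⟨⟨F.top X, rfl⟩, fun A => F.le_top A.1⟩,
    fun _ A B => ⟨⟨F.join A.1 B.1, rfl⟩, F.le_join_left A.1 B.1, F.le_join_right A.1 B.1,
      fun _ h h' => F.join_le h h'⟩,
    fun _ A B => ⟨⟨F.meet A.1 B.1, rfl⟩, F.meet_le_left A.1 B.1, F.meet_le_right A.1 B.1,
      fun _ h h' => F.le_meet h h'⟩,
    fun f S => ⟨⟨F.dimg f S.1, rfl⟩, F.rel_dimg f S.1, fun _ h => F.dimg_le h⟩,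
    fun f T => ⟨⟨F.iimg f T.1, rfl⟩, F.iimg_rel f T.1, fun _ h => F.le_iimg h⟩,
    fun _ _ _ _ h => ?_⟩
  obtain ⟨B, h1, h2⟩ := F.rel_decomp h
  exact ⟨⟨B, rfl⟩, h1, h2⟩

theorem core_id (F : OreanForm C) (h : F.IsBinormalForm) :
    IsDecompCore F F.toForm.idOp F.toForm.idOp :=
  ⟨fun _ => rfl, fun _ => rfl, fixed_orean F,
    (fixed_conormal F _ fun _ _ => rfl).2 h.1, fixed_orean F,
    (fixed_normal F _ fun _ _ => rfl).2 h.2⟩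

theorem exact_id (F : OreanForm C) (h : F.IsBinormalForm) :
    IsExact F F.toForm.idOp F.toForm.idOp := by
  have hc := core_id F h
  refine ⟨⟨⟨⟨fun A => ⟨A, rfl⟩, fun h => h⟩, fun _ => rfl, ?_, ?_⟩,
    ⟨⟨fun A => ⟨A, rfl⟩, fun h => h⟩, fun _ => rfl, ?_, ?_⟩, hc.2.2.1, hc.2.2.2.1,
    hc.2.2.2.2.1, hc.2.2.2.2.2, ⟨Form.idOp _, fun _ _ h => h⟩, ⟨Form.idOp _, fun _ _ h => h⟩⟩, ?_, ?_⟩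
  · exact fun f S h => (fixed_image _ _ (fun _ _ => rfl) f _).2 h
  · exact fun f S h => (fixed_kernel _ _ (fun _ _ => rfl) f _).2 h
  · exact fun f S h => (fixed_image _ _ (fun _ _ => rfl) f _).2 h
  · exact fun f S h => (fixed_kernel _ _ (fun _ _ => rfl) f _).2 h
  · exact fun f S h => (fixed_image _ _ (fun _ _ => rfl) f _).1 h
  · exact fun f S h => (fixed_kernel _ _ (fun _ _ => rfl) f _).1 h

theorem exact_fix_image (F : OreanForm C) {κs κe : Operator F.toForm F.toForm}
    (h : IsExact F κs κe) {X : C} {S : F.Cl X} (hS : F.toForm.ConormalCl S) :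
    κs.app S = S := by
  obtain ⟨⟨⟨τ, h1, h2, -⟩, -⟩, h3, -⟩ := h
  obtain ⟨W, f, hf⟩ := hS
  have := h3 f _ (h2 f S hf)
  rw [← h1]
  exact image_unique _ this hf

theorem exact_fix_kernel (F : OreanForm C) {κs κe : Operator F.toForm F.toForm}
    (h : IsExact F κs κe) {X : C} {S : F.Cl X} (hS : F.toForm.NormalCl S) :
    κe.app S = S := by
  obtain ⟨⟨-, ⟨τ, h1, -, h2⟩, -⟩, -, h3⟩ := h
  obtain ⟨W, f, hf⟩ := hS
  have := h3 f _ (h2 f S hf)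
  rw [← h1]
  exact kernel_unique _ this hf

theorem exact_conormal_of_fix (F : OreanForm C) {κs κe : Operator F.toForm F.toForm}
    (h : IsExact F κs κe) {X : C} {S : F.Cl X} (hS : κs.app S = S) :
    F.toForm.ConormalCl S := by
  obtain ⟨⟨-, -, hp⟩, h3, -⟩ := h
  obtain ⟨W, f, hf⟩ := hp.2.1 X ⟨S, hS⟩
  exact ⟨W, f, h3 f _ hf⟩

theorem exact_normal_of_fix (F : OreanForm C) {κs κe : Operator F.toForm F.toForm}
    (h : IsExact F κs κe) {X : C} {S : F.Cl X} (hS : κe.app S = S) :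
    F.toForm.NormalCl S := by
  obtain ⟨⟨-, -, hp⟩, -, h3⟩ := h
  obtain ⟨W, f, hf⟩ := hp.2.2.2.1 X ⟨S, hS⟩
  exact ⟨W, f, h3 f _ hf⟩

/-- If the bottom clusters are conormal, then `κs (Ker f) ≤ Ker f`. -/
theorem exact_ks_kernel_le (F : OreanForm C) {κs κe : Operator F.toForm F.toForm}
    (h : IsExact F κs κe) {X Y : C} (g : X ⟶ Y) {S : F.Cl X} (hS : F.toForm.IsKernelOf S g)
    (hb : κs.app (F.bot Y) = F.bot Y) : F.Rel (𝟙 X) (κs.app S) S := by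
  obtain ⟨⟨⟨τ, h1, -, h2⟩, -⟩, -⟩ := h
  obtain ⟨b, hb1, hb2, -⟩ := h2 g S hS
  have e : b.1 = F.bot Y := F.rel_antisymm (hb1 ⟨_, hb⟩) (F.bot_le _)
  have hr : F.Rel g (τ.app S).1 b.1 := hb2
  rw [e, h1] at hr
  rw [kernel_unique _ hS (isKernelOf_Ker F g)] at hr ⊢
  exact F.le_iimg hr

/-- If the top clusters are normal, then `Im f ≤ κe (Im f)`. -/
theorem exact_le_ke_image (F : OreanForm C) {κs κe : Operator F.toForm F.toForm}
    (h : IsExact F κs κe) {W X : C} (g : W ⟶ X) {S : F.Cl X} (hS : F.toForm.IsImageOf S g)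
    (hb : κe.app (F.top W) = F.top W) : F.Rel (𝟙 X) S (κe.app S) := by
  obtain ⟨⟨-, ⟨τ, h1, h2, -⟩, -⟩, -⟩ := h
  obtain ⟨b, hb1, hb2, -⟩ := h2 g S hS
  have e : b.1 = F.top W := F.rel_antisymm (F.le_top _) (hb1 ⟨_, hb⟩)
  have hr : F.Rel g b.1 (τ.app S).1 := hb2
  rw [e, h1] at hr
  rw [image_unique _ hS (isImageOf_Im F g)] at hr ⊢
  exact F.dimg_le hr

theorem join_meet_binormal (F : OreanForm C) {κs κe ls le : Operator F.toForm F.toForm}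
    (hj : IsJoinDecomp F κs κe) (hje : IsExact F κs κe)
    (hm : IsMeetDecomp F ls le) (hme : IsExact F ls le) : F.IsBinormalForm := by
  obtain ⟨hjc, hj⟩ := hj
  obtain ⟨hmc, hm⟩ := hm
  have ks_le : ∀ {X : C} (S : F.Cl X), F.Rel (𝟙 X) (κs.app S) S := fun S => by
    conv => arg 4; rw [hj S]
    exact F.le_join_left _ _
  have ke_le : ∀ {X : C} (S : F.Cl X), F.Rel (𝟙 X) (κe.app S) S := fun S => by
    conv => arg 4; rw [hj S]
    exact F.le_join_right _ _
  have le_ls : ∀ {X : C} (S : F.Cl X), F.Rel (𝟙 X) S (ls.app S) := fun S => by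
    conv => arg 3; rw [hm S]
    exact F.meet_le_left _ _
  have le_le : ∀ {X : C} (S : F.Cl X), F.Rel (𝟙 X) S (le.app S) := fun S => by
    conv => arg 3; rw [hm S]
    exact F.meet_le_right _ _
  have hbot : ∀ X : C, ls.app (F.bot X) = F.bot X := fun X =>
    exact_fix_image F hme (exact_conormal_of_fix F hje
      (F.rel_antisymm (ks_le _) (F.bot_le _)))
  have htop : ∀ X : C, κe.app (F.top X) = F.top X := fun X =>
    exact_fix_kernel F hje (exact_normal_of_fix F hme
      (F.rel_antisymm (F.le_top _) (le_le _)))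
  have n_c : ∀ {X : C} {S : F.Cl X}, F.toForm.NormalCl S → F.toForm.ConormalCl S := by
    rintro X S ⟨Y, g, hg⟩
    exact exact_conormal_of_fix F hme
      (F.rel_antisymm (exact_ks_kernel_le F hme g hg (hbot Y)) (le_ls S))
  have c_n : ∀ {X : C} {S : F.Cl X}, F.toForm.ConormalCl S → F.toForm.NormalCl S := by
    rintro X S ⟨W, g, hg⟩
    exact exact_normal_of_fix F hje
      (F.rel_antisymm (ke_le S) (exact_le_ke_image F hje g hg (htop W)))
  have key : ∀ {X : C} (S : F.Cl X), κs.app S = S := by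
    intro X S
    refine F.rel_antisymm (ks_le S) ?_
    have h1 : κs.app (κe.app S) = κe.app S :=
      exact_fix_image F hje (n_c (exact_normal_of_fix F hje (hjc.2.1 S)))
    have h2 : F.Rel (𝟙 X) (κe.app S) (κs.app S) := by
      rw [← h1]; exact κs.mono (ke_le S)
    conv => arg 3; rw [hj S]
    exact F.join_le (F.rel_id _) h2
  have hc : F.toForm.IsConormal := fun X S => exact_conormal_of_fix F hje (key S)
  exact ⟨(isConormal_iff F).1 hc, (isNormal_iff F).1 fun X S => c_n (hc X S)⟩

theorem join_self (F : OreanForm C) {X : C} (S : F.Cl X) : S = F.join S S :=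
  F.rel_antisymm (F.le_join_left _ _) (F.join_le (F.rel_id _) (F.rel_id _))

theorem meet_self (F : OreanForm C) {X : C} (S : F.Cl X) : S = F.meet S S :=
  F.rel_antisymm (F.le_meet (F.rel_id _) (F.rel_id _)) (F.meet_le_left _ _)

end BinormalAux

/-- Theorem: for an orean form `F : B → C` the following are equivalent:
(i) `F` is binormal; (ii) the pair of identity operators is an exact decomposition
which is simultaneously a left, right, meet and join decomposition; (iii) `F` has a
left decomposition and a right decomposition; (iv) `F` has an exact join decomposition
and an exact meet decomposition; (v) the pair of identity operators is a decomposition.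
Moreover, when `F` is binormal, the pair of identity operators is the only
decomposition that is both left and right, and the only exact decomposition. -/
theorem binormal_decomposition_characterization {C : Type u} [Category.{v} C]
    (F : OreanForm C) :
    (F.IsBinormalForm ↔
      (IsLeftDecomp F F.toForm.idOp F.toForm.idOp ∧
        IsRightDecomp F F.toForm.idOp F.toForm.idOp ∧
        IsMeetDecomp F F.toForm.idOp F.toForm.idOp ∧
        IsJoinDecomp F F.toForm.idOp F.toForm.idOp ∧
        IsExact F F.toForm.idOp F.toForm.idOp)) ∧
    (F.IsBinormalForm ↔
      ((∃ κs κe : Operator F.toForm F.toForm, IsLeftDecomp F κs κe) ∧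
        (∃ κs κe : Operator F.toForm F.toForm, IsRightDecomp F κs κe))) ∧
    (F.IsBinormalForm ↔
      ((∃ κs κe : Operator F.toForm F.toForm, IsJoinDecomp F κs κe ∧ IsExact F κs κe) ∧
        (∃ κs κe : Operator F.toForm F.toForm, IsMeetDecomp F κs κe ∧ IsExact F κs κe))) ∧
    (F.IsBinormalForm ↔ IsDecomp F F.toForm.idOp F.toForm.idOp) ∧
    (F.IsBinormalForm →
      (∀ κs κe : Operator F.toForm F.toForm, IsLeftDecomp F κs κe → IsRightDecomp F κs κe →
        ∀ {X : C} (S : F.Cl X), κs.app S = S ∧ κe.app S = S) ∧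
      (∀ κs κe : Operator F.toForm F.toForm, IsDecomp F κs κe → IsExact F κs κe →
        ∀ {X : C} (S : F.Cl X), κs.app S = S ∧ κe.app S = S)) := by
  have c := BinormalAux.core_id F
  have e := BinormalAux.exact_id F
  have hj : JoinEq F F.toForm.idOp F.toForm.idOp := fun S => BinormalAux.join_self F S
  have hm : MeetEq F F.toForm.idOp F.toForm.idOp := fun S => BinormalAux.meet_self F S
  have hl : LeftEq F F.toForm.idOp := fun S => rfl
  have hr : RightEq F F.toForm.idOp := fun S => rfl
  have back : IsDecompCore F F.toForm.idOp F.toForm.idOp → F.IsBinormalForm := fun h =>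
    ⟨(BinormalAux.fixed_conormal F _ fun _ _ => rfl).1 h.2.2.2.1,
      (BinormalAux.fixed_normal F _ fun _ _ => rfl).1 h.2.2.2.2.2⟩
  refine ⟨⟨fun h => ⟨⟨c h, hl⟩, ⟨c h, hr⟩, ⟨c h, hm⟩, ⟨c h, hj⟩, e h⟩, fun h => back h.1.1⟩,
    ⟨fun h => ⟨⟨_, _, c h, hl⟩, ⟨_, _, c h, hr⟩⟩, ?_⟩,
    ⟨fun h => ⟨⟨_, _, ⟨c h, hj⟩, e h⟩, ⟨_, _, ⟨c h, hm⟩, e h⟩⟩, ?_⟩,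
    ⟨fun h => ⟨c h, Or.inl hj⟩, fun h => back h.1⟩, fun h => ⟨?_, ?_⟩⟩
  · rintro ⟨⟨κs, κe, h1, h2⟩, ⟨ls, le, h3, h4⟩⟩
    exact ⟨(BinormalAux.fixed_conormal F κs fun _ A => (h2 A).symm).1 h1.2.2.2.1,
      (BinormalAux.fixed_normal F le fun _ A => (h4 A).symm).1 h3.2.2.2.2.2⟩
  · rintro ⟨⟨κs, κe, h1, h2⟩, ⟨ls, le, h3, h4⟩⟩
    exact BinormalAux.join_meet_binormal F h1 h2 h3 h4
  · intro κs κe h1 h2 X S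
    exact ⟨(h1.2 S).symm, (h2.2 S).symm⟩
  · intro κs κe _ h2 X S
    exact ⟨BinormalAux.exact_fix_image F h2 ((BinormalAux.isConormal_iff F).2 h.1 X S),
      BinormalAux.exact_fix_kernel F h2 ((BinormalAux.isNormal_iff F).2 h.2 X S)⟩
end
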